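/- Let d ≥ 2 and n ≥ 1 be integers and let 0 ≤ k < n, p = k/n, p_μ = binom(n,k)·p^k·(1−p)^{n−k}. Then there exists a d-regular bipartite multigraph on 2n vertices, given by a biadjacency matrix A : Fin n × Fin n → ℕ with all row sums and all column sums equal to d, such that m_k(A) ≤ √((1−p/d)/(1−p)) · p_μ · exp(2n·Γ_d(p)). -/

import Mathlib

/-- The entropy function `Γ_d(p)` of the infinite `d`-regular tree.
(In Lean, `Real.log 0 = 0`, which implements the convention `0 · ln 0 = 0`.) -/
noncomputable def Gammad (d : ℕ) (p : ℝ) : ℝ :=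
  (1 / 2) * (p * Real.log ((d : ℝ) / p) + ((d : ℝ) - p) * Real.log (1 - p / d)
    - 2 * (1 - p) * Real.log (1 - p))

/-- The number of `k`-matchings of the bipartite multigraph with biadjacency matrix `A`:
`m_k(A) = Σ_{S,T} per(A[S,T])`, where the sum runs over all `k`-element subsets `S` of
the rows and `T` of the columns, and the permanent is written as a sum over bijections
`S ≃ T` of the products of the corresponding entries. -/
def mMulti {n : ℕ} (A : Fin n → Fin n → ℕ) (k : ℕ) : ℕ :=
  ∑ S ∈ Finset.univ.powersetCard k, ∑ T ∈ Finset.univ.powersetCard k,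
    ∑ σ : {x // x ∈ S} ≃ {y // y ∈ T}, ∏ i : {x // x ∈ S}, A i.1 (σ i).1

open Finset in
lemma Equiv.Perm.card_filter_forall_apply_eq {α ι : Type*} [Fintype α] [DecidableEq α]
    [Fintype ι] {u v : ι → α} (hu : Function.Injective u) (hv : Function.Injective v) :
    #{π : Equiv.Perm α | ∀ i, π (u i) = v i} =
      (Fintype.card α - Fintype.card ι).factorial := by
  classical
  obtain ⟨e, he⟩ := Equiv.Perm.exists_extending_pair u v hu hv
  have hcard : Fintype.card {x // x ∉ Set.range u} = Fintype.card α - Fintype.card ι := by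
    rw [Fintype.card_subtype_compl]
    congr 1
    exact (Fintype.card_congr (Equiv.ofInjective u hu)).symm
  rw [← hcard, ← Fintype.card_perm,
    Fintype.card_congr (Equiv.Perm.subtypeEquivSubtypePerm fun x ↦ x ∉ Set.range u),
    Fintype.card_subtype]
  refine card_equiv (Equiv.mulLeft e⁻¹) fun π ↦ ?_
  simp only [mem_filter, mem_univ, true_and, not_not, Set.forall_mem_range,
    Equiv.coe_mulLeft, Equiv.Perm.mul_apply, Equiv.Perm.inv_eq_iff_eq, he]

/-- The biadjacency matrix of the bipartite multigraph obtained from the perfect matching `π` of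
half-edges, `d` at every vertex, by forgetting the second coordinates. -/
def configMatrix {n d : ℕ} (π : Equiv.Perm (Fin n × Fin d)) (i j : Fin n) : ℕ :=
  ∑ c : Fin d × Fin d, if π (i, c.1) = (j, c.2) then 1 else 0

lemma sum_configMatrix_row {n d : ℕ} (π : Equiv.Perm (Fin n × Fin d)) (i : Fin n) :
    ∑ j, configMatrix π i j = d := by
  simp only [configMatrix, Fintype.sum_prod_type]
  rw [Finset.sum_comm]
  have h (a : Fin d) : (∑ j, ∑ b, if π (i, a) = (j, b) then 1 else 0) = 1 := by
    rw [← Fintype.sum_prod_type' (fun j b ↦ if π (i, a) = (j, b) then 1 else 0)]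
    simp
  rw [Finset.sum_congr rfl fun a _ ↦ h a]
  simp

lemma sum_configMatrix_col {n d : ℕ} (π : Equiv.Perm (Fin n × Fin d)) (j : Fin n) :
    ∑ i, configMatrix π i j = d := by
  refine Eq.trans ?_ (sum_configMatrix_row π.symm j)
  refine Finset.sum_congr rfl fun i _ ↦ ?_
  simp only [configMatrix]
  refine Fintype.sum_equiv (Equiv.prodComm _ _) _ _ fun c ↦ ?_
  simp [Equiv.symm_apply_eq, @eq_comm _ (j, c.2)]

open Finset in
lemma sum_mMulti_configMatrix (n d k : ℕ) :
    ∑ π : Equiv.Perm (Fin n × Fin d), mMulti (configMatrix π) k =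
      n.choose k ^ 2 * k.factorial * d ^ (2 * k) * (n * d - k).factorial := by
  have key {S T : Finset (Fin n)} (hS : #S = k) (σ : {x // x ∈ S} ≃ {y // y ∈ T}) :
      ∑ π : Equiv.Perm (Fin n × Fin d), ∏ i : {x // x ∈ S}, configMatrix π i.1 (σ i).1 =
        d ^ (2 * k) * (n * d - k).factorial := by
    simp only [configMatrix, prod_univ_sum, Fintype.piFinset_univ]
    rw [sum_comm]
    have h (c : {x // x ∈ S} → Fin d × Fin d) :
        (∑ π : Equiv.Perm (Fin n × Fin d), ∏ i : {x // x ∈ S},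
          if π (i.1, (c i).1) = ((σ i).1, (c i).2) then 1 else 0) =
        (n * d - k).factorial := by
      simp only [prod_ite_zero, prod_const_one, sum_boole, mem_univ, forall_const, Nat.cast_id]
      rw [Equiv.Perm.card_filter_forall_apply_eq]
      · simp [hS]
      · intro x y h
        exact Subtype.ext (congrArg Prod.fst h)
      · intro x y h
        exact σ.injective (Subtype.ext (congrArg Prod.fst h))
    simp only [h, sum_const, card_univ, Fintype.card_fun, Fintype.card_prod, Fintype.card_fin,
      Fintype.card_coe, hS, smul_eq_mul]
    rw [← sq, ← pow_mul]
  simp only [mMulti]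
  rw [sum_comm]
  simp_rw [sum_comm (s := (univ : Finset (Equiv.Perm (Fin n × Fin d))))]
  have h {S T : Finset (Fin n)} (hS : #S = k) (hT : #T = k) :
      ∑ σ : {x // x ∈ S} ≃ {y // y ∈ T}, ∑ π : Equiv.Perm (Fin n × Fin d),
        ∏ i : {x // x ∈ S}, configMatrix π i.1 (σ i).1 =
      k.factorial * (d ^ (2 * k) * (n * d - k).factorial) := by
    simp only [key hS, sum_const, card_univ, smul_eq_mul]
    have e : {x // x ∈ S} ≃ {y // y ∈ T} := Fintype.equivOfCardEq (by simp [hS, hT])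
    rw [Fintype.card_equiv e, Fintype.card_coe, hS]
  rw [sum_congr rfl fun S hS ↦ sum_congr rfl fun T hT ↦
    h (mem_powersetCard.1 hS).2 (mem_powersetCard.1 hT).2]
  simp only [sum_const, card_powersetCard, card_univ, Fintype.card_fin, smul_eq_mul]
  ring

namespace Stirling

lemma log_stirlingSeq_sub_log_succ_antitone {a b : ℕ} (ha : 1 ≤ a) (hab : a ≤ b) :
    Real.log (stirlingSeq b) - Real.log (stirlingSeq (b + 1)) ≤
      Real.log (stirlingSeq a) - Real.log (stirlingSeq (a + 1)) := by
  obtain ⟨a, rfl⟩ := Nat.exists_eq_add_of_le' ha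
  obtain ⟨b, rfl⟩ := Nat.exists_eq_add_of_le' (ha.trans hab)
  refine hasSum_le (fun i ↦ ?_) (log_stirlingSeq_sdiff_hasSum b) (log_stirlingSeq_sdiff_hasSum a)
  have : (a : ℝ) ≤ b := by exact_mod_cast Nat.le_of_succ_le_succ hab
  push_cast
  gcongr

lemma stirlingSeq_div_stirlingSeq_sub_mono {k a b : ℕ} (ha : k < a) (hab : a ≤ b) :
    stirlingSeq a * stirlingSeq (b - k) ≤ stirlingSeq b * stirlingSeq (a - k) := by
  have hpos {m : ℕ} (hm : 0 < m) : 0 < stirlingSeq m := by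
    obtain ⟨m, rfl⟩ := Nat.exists_eq_add_of_le' hm
    exact stirlingSeq'_pos m
  rw [← Real.log_le_log_iff (mul_pos (hpos (by omega)) (hpos (by omega)))
    (mul_pos (hpos (by omega)) (hpos (by omega))),
    Real.log_mul (hpos (by omega)).ne' (hpos (by omega)).ne',
    Real.log_mul (hpos (by omega)).ne' (hpos (by omega)).ne']
  induction b, hab using Nat.le_induction with
  | base => exact le_rfl
  | succ b hab ih =>
    have h := log_stirlingSeq_sub_log_succ_antitone (a := b - k) (b := b) (by omega) (by omega)
    rw [Nat.sub_add_comm (by omega : k ≤ b)]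
    linarith

lemma factorial_eq_stirlingSeq_mul {m : ℕ} (hm : 0 < m) :
    (m.factorial : ℝ) = stirlingSeq m * (√(2 * m) * (m / Real.exp 1) ^ m) := by
  rw [stirlingSeq, div_mul_cancel₀]
  positivity

end Stirling

lemma factorial_mul_factorial_sub_le {k a b : ℕ} (ha : k < a) (hab : a ≤ b) :
    (a.factorial * (b - k).factorial : ℝ) ≤
      √((1 - (k : ℝ) / b) / (1 - (k : ℝ) / a)) *
        ((a : ℝ) ^ a * ((b - k : ℕ) : ℝ) ^ (b - k)) /
          (((a - k : ℕ) : ℝ) ^ (a - k) * (b : ℝ) ^ b) * ((a - k).factorial * b.factorial) := by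
  have hmono := Stirling.stirlingSeq_div_stirlingSeq_sub_mono ha hab
  rw [Stirling.factorial_eq_stirlingSeq_mul (by omega : 0 < a),
    Stirling.factorial_eq_stirlingSeq_mul (by omega : 0 < b - k),
    Stirling.factorial_eq_stirlingSeq_mul (by omega : 0 < a - k),
    Stirling.factorial_eq_stirlingSeq_mul (by omega : 0 < b)]
  obtain ⟨x, rfl⟩ := Nat.exists_eq_add_of_le' ha.le
  obtain ⟨y, rfl⟩ := Nat.exists_eq_add_of_le' (ha.le.trans hab)
  simp only [Nat.add_sub_cancel] at hmono ⊢
  have hx : (0 : ℝ) < x := by exact_mod_cast (by omega : 0 < x)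
  have hy : (0 : ℝ) < y := by exact_mod_cast (by omega : 0 < y)
  have hX : (0 : ℝ) < (x + k : ℕ) := by exact_mod_cast (by omega : 0 < x + k)
  have hY : (0 : ℝ) < (y + k : ℕ) := by exact_mod_cast (by omega : 0 < y + k)
  have hsqrt : √((1 - (k : ℝ) / (y + k : ℕ)) / (1 - (k : ℝ) / (x + k : ℕ))) *
      (√(2 * x) * √(2 * (y + k : ℕ))) = √(2 * (x + k : ℕ)) * √(2 * y) := by
    have h1 : 1 - (k : ℝ) / (x + k : ℕ) = x / (x + k : ℕ) := by
      rw [eq_div_iff hX.ne', sub_mul, div_mul_cancel₀ _ hX.ne']; push_cast; ring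
    have h2 : 1 - (k : ℝ) / (y + k : ℕ) = y / (y + k : ℕ) := by
      rw [eq_div_iff hY.ne', sub_mul, div_mul_cancel₀ _ hY.ne']; push_cast; ring
    rw [h1, h2, ← Real.sqrt_mul (by positivity), ← Real.sqrt_mul (by positivity),
      ← Real.sqrt_mul (by positivity)]
    congr 1
    field_simp
  generalize √((1 - (k : ℝ) / (y + k : ℕ)) / (1 - (k : ℝ) / (x + k : ℕ))) = r at hsqrt ⊢
  set q : ℝ := √(2 * (x + k : ℕ)) * √(2 * y) * ((x + k : ℕ) / Real.exp 1) ^ (x + k) *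
    (y / Real.exp 1) ^ y with hq
  calc _ = Stirling.stirlingSeq (x + k) * Stirling.stirlingSeq y * q := by rw [hq]; ring
    _ ≤ Stirling.stirlingSeq (y + k) * Stirling.stirlingSeq x * q := by gcongr
    _ = _ := by
      rw [hq, ← hsqrt]
      simp only [div_pow, pow_add]
      have := Real.exp_pos 1
      field_simp

lemma exp_two_mul_Gammad {d n k : ℕ} (hd : 1 < d) (hk : k < n) :
    Real.exp (2 * n * Gammad d ((k : ℝ) / n)) =
      (d / ((k : ℝ) / n)) ^ k * (1 - (k : ℝ) / n / d) ^ (n * d - k) /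
        (1 - (k : ℝ) / n) ^ (2 * (n - k)) := by
  have hn : (0 : ℝ) < n := by exact_mod_cast (by omega : 0 < n)
  have hd0 : (1 : ℝ) < d := by exact_mod_cast hd
  have hp : (k : ℝ) / n < 1 := by rw [div_lt_one hn]; exact_mod_cast hk
  have hpd : (k : ℝ) / n / d < 1 := by rw [div_lt_one (by linarith)]; linarith
  have hle : k ≤ n * d := hk.le.trans (Nat.le_mul_of_pos_right n (by omega))
  have hpow : ((d : ℝ) / ((k : ℝ) / n)) ^ k = Real.exp (k * Real.log (d / ((k : ℝ) / n))) := by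
    rcases Nat.eq_zero_or_pos k with rfl | h
    · simp
    · rw [Real.exp_nat_mul, Real.exp_log (by positivity)]
  rw [hpow, ← Real.exp_log (sub_pos.2 hpd), ← Real.exp_log (sub_pos.2 hp),
    ← Real.exp_nat_mul, ← Real.exp_nat_mul, ← Real.exp_add, ← Real.exp_sub]
  congr 1
  rw [Gammad]
  push_cast [Nat.cast_sub hle, Nat.cast_sub hk.le]
  generalize Real.log (d / ((k : ℝ) / n)) = u
  generalize Real.log (1 - (k : ℝ) / n / d) = v
  generalize Real.log (1 - (k : ℝ) / n) = w
  field_simp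

/-- There is a `d`-regular bipartite multigraph on `2n` vertices with at most
`√((1-p/d)/(1-p)) · p_μ · exp(2n·Γ_d(p))` matchings of size `k`. -/
theorem exists_dRegular_multigraph_few_matchings (d n : ℕ) (hd : 2 ≤ d) (hn : 1 ≤ n)
    (k : ℕ) (hk : k < n) (p pμ : ℝ) (hp : p = (k : ℝ) / n)
    (hpμ : pμ = (n.choose k : ℝ) * p ^ k * (1 - p) ^ (n - k)) :
    ∃ A : Fin n → Fin n → ℕ,
      (∀ i, ∑ j, A i j = d) ∧ (∀ j, ∑ i, A i j = d) ∧
      (mMulti A k : ℝ) ≤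
        Real.sqrt ((1 - p / d) / (1 - p)) * pμ * Real.exp (2 * n * Gammad d p) := by
  subst hp hpμ
  have hle : n ≤ n * d := Nat.le_mul_of_pos_right n (by omega)
  obtain ⟨π, -, hπ⟩ := Finset.exists_le_of_sum_le
    (s := (Finset.univ : Finset (Equiv.Perm (Fin n × Fin d))))
    (f := fun π ↦ mMulti (configMatrix π) k * (n * d).factorial)
    (g := fun _ ↦ n.choose k ^ 2 * k.factorial * d ^ (2 * k) * (n * d - k).factorial)
    Finset.univ_nonempty (by
      rw [← Finset.sum_mul, sum_mMulti_configMatrix]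
      simp [Fintype.card_perm, mul_comm])
  refine ⟨configMatrix π, sum_configMatrix_row π, sum_configMatrix_col π, ?_⟩
  have hchoose : (n.choose k * k.factorial * (n - k).factorial : ℝ) = n.factorial := by
    exact_mod_cast Nat.choose_mul_factorial_mul_factorial hk.le
  have hfac := factorial_mul_factorial_sub_le hk hle
  have hn0 : (0 : ℝ) < n := by exact_mod_cast hn
  have hd0 : (0 : ℝ) < d := by exact_mod_cast (by omega : 0 < d)
  rw [exp_two_mul_Gammad hd hk, div_div]
  rw [Nat.cast_mul n d] at hfac
  set r := √((1 - (k : ℝ) / (n * d)) / (1 - (k : ℝ) / n))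
  have hπ' : (mMulti (configMatrix π) k * (n * d).factorial : ℝ) ≤
      n.choose k ^ 2 * k.factorial * d ^ (2 * k) * (n * d - k).factorial := by
    exact_mod_cast hπ
  have hnk : 1 - (k : ℝ) / n = (n - k : ℕ) / n := by
    rw [Nat.cast_sub hk.le]; field_simp
  have hNk : 1 - (k : ℝ) / (n * d) = (n * d - k : ℕ) / (n * d) := by
    rw [Nat.cast_sub (hk.le.trans hle)]; push_cast; field_simp
  have hpk : ((k : ℝ) / n) ^ k * (d / ((k : ℝ) / n)) ^ k = d ^ k := by
    rcases Nat.eq_zero_or_pos k with rfl | h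
    · simp
    · rw [← mul_pow, mul_div_cancel₀ _ (by positivity)]
  have hx : (0 : ℝ) < (n - k : ℕ) := by exact_mod_cast (by omega : 0 < n - k)
  have hsplit : (n : ℝ) ^ n = n ^ (n - k) * n ^ k := by rw [← pow_add]; congr 1; omega
  have hsplit' : ((n : ℝ) * d) ^ (n * d) = (n * d) ^ (n * d - k) * (n ^ k * d ^ k) := by
    rw [← mul_pow, ← pow_add]; congr 1; omega
  have hbound : (mMulti (configMatrix π) k : ℝ) * ((n - k).factorial * (n * d).factorial) ≤
      n.choose k * d ^ (2 * k) * (r * ((n : ℝ) ^ n * ((n * d - k : ℕ) : ℝ) ^ (n * d - k)) /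
          (((n - k : ℕ) : ℝ) ^ (n - k) * ((n : ℝ) * d) ^ (n * d))) *
        ((n - k).factorial * (n * d).factorial) :=
    calc _ = mMulti (configMatrix π) k * (n * d).factorial * ((n - k).factorial : ℝ) := by ring
      _ ≤ n.choose k ^ 2 * k.factorial * d ^ (2 * k) * (n * d - k).factorial *
          ((n - k).factorial : ℝ) := by gcongr
      _ = n.choose k * d ^ (2 * k) * (n.factorial * (n * d - k).factorial : ℝ) := by
        rw [← hchoose]; ring
      _ ≤ n.choose k * d ^ (2 * k) *
          (r * ((n : ℝ) ^ n * ((n * d - k : ℕ) : ℝ) ^ (n * d - k)) /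
            (((n - k : ℕ) : ℝ) ^ (n - k) * ((n : ℝ) * d) ^ (n * d)) *
          ((n - k).factorial * (n * d).factorial)) := by gcongr
      _ = _ := by ring
  refine (le_of_mul_le_mul_right hbound (by positivity)).trans_eq ?_
  calc _ = r * n.choose k * (((k : ℝ) / n) ^ k * (d / ((k : ℝ) / n)) ^ k) *
      ((1 - (k : ℝ) / (n * d)) ^ (n * d - k) / (1 - (k : ℝ) / n) ^ (n - k)) := by
        rw [hpk, hnk, hNk, hsplit, hsplit', div_pow, div_pow, two_mul, pow_add]
        field_simp
    _ = _ := by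
      have : (1 - (k : ℝ) / n) ≠ 0 := by rw [hnk]; positivity
      rw [two_mul, pow_add]
      generalize 1 - (k : ℝ) / n = t at *
      field_simp
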